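/- If f(d) denotes the maximal number of simplices in a triangulation of a combinatorial d-cube (maximized over all coordinatizations), and f(d_1) ≥ c_1^{d_1} d_1! and f(d_2) ≥ c_2^{d_2} d_2!, then f(d_1 + d_2) ≥ c_1^{d_1} c_2^{d_2} (d_1 + d_2)!. -/

import Mathlib

open Set
open scoped Classical

noncomputable section

abbrev PtD (d : ℕ) := Fin d → ℝ

/-- A `d`-simplex: `d + 1` affinely independent points in `ℝ^d`. -/
def IsSimplexD (d : ℕ) (σ : Finset (PtD d)) : Prop :=
  σ.card = d + 1 ∧ AffineIndependent ℝ (fun p : (σ : Set (PtD d)) => (p : PtD d))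

/-- A triangulation of the polytope `conv V ⊆ ℝ^d` using only vertices in `V`. -/
def IsTriangulationD (d : ℕ) (V : Finset (PtD d)) (T : Finset (Finset (PtD d))) : Prop :=
  (∀ σ ∈ T, IsSimplexD d σ ∧ (σ : Set (PtD d)) ⊆ (V : Set (PtD d))) ∧
  (∀ σ ∈ T, ∀ τ ∈ T, σ ≠ τ →
    interior (convexHull ℝ (σ : Set (PtD d))) ∩ interior (convexHull ℝ (τ : Set (PtD d))) = ∅) ∧
  (⋃ σ ∈ T, convexHull ℝ (σ : Set (PtD d))) = convexHull ℝ (V : Set (PtD d)) ∧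
  (∀ σ ∈ T, ∀ τ ∈ T,
    convexHull ℝ (σ : Set (PtD d)) ∩ convexHull ℝ (τ : Set (PtD d))
      = convexHull ℝ ((σ ∩ τ : Finset (PtD d)) : Set (PtD d)))

/-- The vertices of the standard cube `[0,1]^d`. -/
def stdCubeVerts (d : ℕ) : Finset (PtD d) :=
  (Finset.univ : Finset (Fin d → Bool)).image (fun b i => if b i then 1 else 0)

/-- `V` is the vertex set of a combinatorial `d`-cube: there is a bijection from
the vertices of the standard cube `[0,1]^d` to `V` inducing an isomorphism of
face lattices (faces being encoded as extreme subsets spanned by vertex sets). -/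
def IsCombCube (d : ℕ) (V : Finset (PtD d)) : Prop :=
  ∃ ψ : PtD d → PtD d, Set.BijOn ψ (stdCubeVerts d : Set (PtD d)) (V : Set (PtD d)) ∧
    ∀ S ⊆ (stdCubeVerts d : Set (PtD d)),
      (IsExtreme ℝ (convexHull ℝ (stdCubeVerts d : Set (PtD d))) (convexHull ℝ S) ↔
       IsExtreme ℝ (convexHull ℝ (V : Set (PtD d))) (convexHull ℝ (ψ '' S)))

section Comb

variable {α β K L : Type*} [LinearOrder K] [LinearOrder L]

/-- A set of pairs that is a chain with respect to the keys `u`, `v`. -/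
def ChainK (u : α → K) (v : β → L) (A : Finset (α × β)) : Prop :=
  ∀ p ∈ A, ∀ q ∈ A, u p.1 < u q.1 → v p.2 ≤ v q.2

/-- Staircases (maximal chains) in `s × t`. -/
def Stair (u : α → K) (v : β → L) (s : Finset α) (t : Finset β) : Finset (Finset (α × β)) :=
  (s ×ˢ t).powerset.filter (fun A => ChainK u v A ∧ A.card + 1 = s.card + t.card ∧
    A.image Prod.fst = s ∧ A.image Prod.snd = t)

theorem mem_stair {u : α → K} {v : β → L} {s : Finset α} {t : Finset β} {A : Finset (α × β)} :
    A ∈ Stair u v s t ↔ A ⊆ s ×ˢ t ∧ ChainK u v A ∧ A.card + 1 = s.card + t.card ∧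
    A.image Prod.fst = s ∧ A.image Prod.snd = t := by
  simp [Stair]

theorem stair_base_left (u : α → K) (v : β → L) (x : α) (t : Finset β) (ht : t.Nonempty) :
    ({x} : Finset α) ×ˢ t ∈ Stair u v {x} t := by
  rw [mem_stair]
  refine ⟨subset_rfl, ?_, ?_, ?_, ?_⟩
  · intro p hp q hq h
    simp only [Finset.mem_product, Finset.mem_singleton] at hp hq
    rw [hp.1, hq.1] at h
    exact absurd h (lt_irrefl _)
  · rw [Finset.card_product]; simp; omega
  · exact Finset.product_image_fst ht
  · exact Finset.product_image_snd (by simp)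

theorem stair_base_right (u : α → K) (v : β → L) (s : Finset α) (y : β) (hs : s.Nonempty) :
    s ×ˢ ({y} : Finset β) ∈ Stair u v s {y} := by
  rw [mem_stair]
  refine ⟨subset_rfl, ?_, ?_, ?_, ?_⟩
  · intro p hp q hq h
    simp only [Finset.mem_product, Finset.mem_singleton] at hp hq
    rw [hp.2, hq.2]
  · rw [Finset.card_product]; simp
  · exact Finset.product_image_fst (by simp)
  · exact Finset.product_image_snd hs

theorem stair_insert_left {u : α → K} {v : β → L} {s : Finset α} {t : Finset β} {x : α} {y : β}
    (hx : x ∉ s) (hy : y ∈ t) (hxm : ∀ i ∈ s, u i ≤ u x) (hym : ∀ j ∈ t, v j ≤ v y)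
    {A : Finset (α × β)} (hA : A ∈ Stair u v s t) :
    insert (x, y) A ∈ Stair u v (insert x s) t := by
  rw [mem_stair] at hA ⊢
  obtain ⟨h1, h2, h3, h4, h5⟩ := hA
  have hn : (x, y) ∉ A := fun h => hx (Finset.mem_product.1 (h1 h)).1
  refine ⟨?_, ?_, ?_, ?_, ?_⟩
  · intro p hp
    rw [Finset.mem_insert] at hp
    rcases hp with rfl | hp
    · simp [hy]
    · have := Finset.mem_product.1 (h1 hp)
      simp [this.1, this.2]
  · intro p hp q hq h
    rw [Finset.mem_insert] at hp hq
    rcases hp with rfl | hp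
    · rcases hq with rfl | hq
      · exact le_rfl
      · exact absurd h (not_lt.2 (hxm _ (Finset.mem_product.1 (h1 hq)).1))
    · rcases hq with rfl | hq
      · exact hym _ (Finset.mem_product.1 (h1 hp)).2
      · exact h2 p hp q hq h
  · rw [Finset.card_insert_of_notMem hn, Finset.card_insert_of_notMem hx]; omega
  · rw [Finset.image_insert, h4]
  · rw [Finset.image_insert, h5]; exact Finset.insert_eq_of_mem hy

theorem stair_insert_right {u : α → K} {v : β → L} {s : Finset α} {t : Finset β} {x : α} {y : β}
    (hx : x ∈ s) (hy : y ∉ t) (hxm : ∀ i ∈ s, u i ≤ u x) (hym : ∀ j ∈ t, v j ≤ v y)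
    {A : Finset (α × β)} (hA : A ∈ Stair u v s t) :
    insert (x, y) A ∈ Stair u v s (insert y t) := by
  rw [mem_stair] at hA ⊢
  obtain ⟨h1, h2, h3, h4, h5⟩ := hA
  have hn : (x, y) ∉ A := fun h => hy (Finset.mem_product.1 (h1 h)).2
  refine ⟨?_, ?_, ?_, ?_, ?_⟩
  · intro p hp
    rw [Finset.mem_insert] at hp
    rcases hp with rfl | hp
    · simp [hx]
    · have := Finset.mem_product.1 (h1 hp)
      simp [this.1, this.2]
  · intro p hp q hq h
    rw [Finset.mem_insert] at hp hq
    rcases hp with rfl | hp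
    · rcases hq with rfl | hq
      · exact le_rfl
      · exact absurd h (not_lt.2 (hxm _ (Finset.mem_product.1 (h1 hq)).1))
    · rcases hq with rfl | hq
      · exact hym _ (Finset.mem_product.1 (h1 hp)).2
      · exact h2 p hp q hq h
  · rw [Finset.card_insert_of_notMem hn, Finset.card_insert_of_notMem hy]; omega
  · rw [Finset.image_insert, h4]; exact Finset.insert_eq_of_mem hx
  · rw [Finset.image_insert, h5]

theorem stair_count (u : α → K) (v : β → L) : ∀ (N m n : ℕ), m + n = N →
    ∀ (s : Finset α) (t : Finset β), s.card = m + 1 → t.card = n + 1 →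
    (m + n).choose m ≤ (Stair u v s t).card := by
  intro N
  induction N with
  | zero =>
    intro m n h s t hs ht
    obtain rfl : m = 0 := by omega
    obtain rfl : n = 0 := by omega
    obtain ⟨x, rfl⟩ := Finset.card_eq_one.1 hs
    simpa using ⟨_, stair_base_left u v x t (Finset.card_pos.1 (by omega))⟩
  | succ N ih =>
    intro m n h s t hs ht
    rcases m with _ | m
    · obtain ⟨x, rfl⟩ := Finset.card_eq_one.1 hs
      simpa using ⟨_, stair_base_left u v x t (Finset.card_pos.1 (by omega))⟩
    rcases n with _ | n
    · obtain ⟨y, rfl⟩ := Finset.card_eq_one.1 ht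
      simpa using ⟨_, stair_base_right u v s y (Finset.card_pos.1 (by omega))⟩
    obtain ⟨x, hx, hxm⟩ := s.exists_max_image u (Finset.card_pos.1 (by omega))
    obtain ⟨y, hy, hym⟩ := t.exists_max_image v (Finset.card_pos.1 (by omega))
    have hs' : (s.erase x).card = m + 1 := by rw [Finset.card_erase_of_mem hx]; omega
    have ht' : (t.erase y).card = n + 1 := by rw [Finset.card_erase_of_mem hy]; omega
    have e1 := ih m (n + 1) (by omega) (s.erase x) t hs' ht
    have e2 := ih (m + 1) n (by omega) s (t.erase y) hs ht'
    have n1 : ∀ A ∈ Stair u v (s.erase x) t, (x, y) ∉ A := fun A hA h => by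
      have := Finset.mem_product.1 ((mem_stair.1 hA).1 h)
      simp at this
    have n2 : ∀ A ∈ Stair u v s (t.erase y), (x, y) ∉ A := fun A hA h => by
      have := Finset.mem_product.1 ((mem_stair.1 hA).1 h)
      simp at this
    have sub : (Stair u v (s.erase x) t ∪ Stair u v s (t.erase y)).image (insert (x, y)) ⊆
        Stair u v s t := by
      intro B hB
      rw [Finset.mem_image] at hB
      obtain ⟨A, hA, rfl⟩ := hB
      rw [Finset.mem_union] at hA
      rcases hA with hA | hA
      · have := stair_insert_left (by simp) hy (fun i hi => hxm i (Finset.mem_of_mem_erase hi))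
          hym hA (x := x)
        rwa [Finset.insert_erase hx] at this
      · have := stair_insert_right hx (by simp) hxm
          (fun i hi => hym i (Finset.mem_of_mem_erase hi)) hA (y := y)
        rwa [Finset.insert_erase hy] at this
    have hinj : Set.InjOn (insert (x, y))
        ((Stair u v (s.erase x) t ∪ Stair u v s (t.erase y) : Finset _) :
          Set (Finset (α × β))) := by
      have nn : ∀ A ∈ Stair u v (s.erase x) t ∪ Stair u v s (t.erase y), (x, y) ∉ A := by
        intro A hA
        rw [Finset.mem_union] at hA
        exact hA.elim (n1 A) (n2 A)
      intro A hA B hB hAB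
      rw [← Finset.erase_insert (nn A hA), ← Finset.erase_insert (nn B hB), hAB]
    have hdisj : Disjoint (Stair u v (s.erase x) t) (Stair u v s (t.erase y)) := by
      rw [Finset.disjoint_left]
      intro A hA hB
      have h1 := (mem_stair.1 hA).2.2.2.2
      have h2 := (mem_stair.1 hB).2.2.2.2
      rw [h1] at h2
      rw [h2] at hy
      simp at hy
    have := Finset.card_le_card sub
    rw [Finset.card_image_of_injOn hinj, Finset.card_union_of_disjoint hdisj] at this
    have e3 : (m + 1 + (n + 1)).choose (m + 1) =
        (m + (n + 1)).choose m + (m + 1 + n).choose (m + 1) := by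
      rw [show m + 1 + (n + 1) = (m + (n + 1)) + 1 by ring, Nat.choose_succ_succ,
        show m + 1 + n = m + (n + 1) by ring]
    omega

theorem stair_cover (u : α → K) (v : β → L) : ∀ (N m n : ℕ), m + n = N →
    ∀ (s : Finset α) (t : Finset β), s.card = m + 1 → t.card = n + 1 →
    ∀ (a : α → ℝ) (b : β → ℝ), (∀ i, 0 ≤ a i) → (∀ j, 0 ≤ b j) → ∑ i ∈ s, a i = ∑ j ∈ t, b j →
    ∃ A ∈ Stair u v s t, ∃ w : α × β → ℝ, (∀ p, 0 ≤ w p) ∧ (∀ p, p ∉ A → w p = 0) ∧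
      (∀ i ∈ s, ∑ j ∈ t, w (i, j) = a i) ∧ (∀ j ∈ t, ∑ i ∈ s, w (i, j) = b j) := by
  have baseL : ∀ (x : α) (t : Finset β), t.Nonempty → 
      ∀ (a : α → ℝ) (b : β → ℝ), (∀ i, 0 ≤ a i) → (∀ j, 0 ≤ b j) →
      ∑ i ∈ {x}, a i = ∑ j ∈ t, b j →
      ∃ A ∈ Stair u v {x} t, ∃ w : α × β → ℝ, (∀ p, 0 ≤ w p) ∧ (∀ p, p ∉ A → w p = 0) ∧
      (∀ i ∈ ({x} : Finset α), ∑ j ∈ t, w (i, j) = a i) ∧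
      (∀ j ∈ t, ∑ i ∈ {x}, w (i, j) = b j) := by
    intro x t ht a b ha hb hab
    refine ⟨_, stair_base_left u v x t ht, fun p => if p ∈ ({x} : Finset α) ×ˢ t then b p.2 else 0,
      ?_, ?_, ?_, ?_⟩
    · intro p
      dsimp only
      split_ifs
      exacts [hb _, le_rfl]
    · intro p hp
      exact if_neg hp
    · intro i hi
      rw [Finset.mem_singleton] at hi
      subst hi
      rw [Finset.sum_singleton] at hab
      rw [hab]
      refine Finset.sum_congr rfl fun j hj => ?_
      simp [hj]
    · intro j hj
      simp [hj]
  have baseR : ∀ (s : Finset α) (y : β), s.Nonempty → 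
      ∀ (a : α → ℝ) (b : β → ℝ), (∀ i, 0 ≤ a i) → (∀ j, 0 ≤ b j) →
      ∑ i ∈ s, a i = ∑ j ∈ {y}, b j →
      ∃ A ∈ Stair u v s {y}, ∃ w : α × β → ℝ, (∀ p, 0 ≤ w p) ∧ (∀ p, p ∉ A → w p = 0) ∧
      (∀ i ∈ s, ∑ j ∈ {y}, w (i, j) = a i) ∧
      (∀ j ∈ ({y} : Finset β), ∑ i ∈ s, w (i, j) = b j) := by
    intro s y hs a b ha hb hab
    refine ⟨_, stair_base_right u v s y hs, fun p => if p ∈ s ×ˢ ({y} : Finset β) then a p.1 else 0,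
      ?_, ?_, ?_, ?_⟩
    · intro p
      dsimp only
      split_ifs
      exacts [ha _, le_rfl]
    · intro p hp
      exact if_neg hp
    · intro j hj
      simp [hj]
    · intro i hi
      rw [Finset.mem_singleton] at hi
      subst hi
      rw [Finset.sum_singleton] at hab
      rw [← hab]
      refine Finset.sum_congr rfl fun j hj => ?_
      simp [hj]
  intro N
  induction N with
  | zero =>
    intro m n h s t hs ht
    obtain rfl : m = 0 := by omega
    obtain ⟨x, rfl⟩ := Finset.card_eq_one.1 hs
    exact baseL x t (Finset.card_pos.1 (by omega))
  | succ N ih =>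
    intro m n h s t hs ht
    rcases m with _ | m
    · obtain ⟨x, rfl⟩ := Finset.card_eq_one.1 hs
      exact baseL x t (Finset.card_pos.1 (by omega))
    rcases n with _ | n
    · obtain ⟨y, rfl⟩ := Finset.card_eq_one.1 ht
      exact baseR s y (Finset.card_pos.1 (by omega))
    intro a b ha hb hab
    obtain ⟨x, hx, hxm⟩ := s.exists_max_image u (Finset.card_pos.1 (by omega))
    obtain ⟨y, hy, hym⟩ := t.exists_max_image v (Finset.card_pos.1 (by omega))
    have hs' : (s.erase x).card = m + 1 := by rw [Finset.card_erase_of_mem hx]; omega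
    have ht' : (t.erase y).card = n + 1 := by rw [Finset.card_erase_of_mem hy]; omega
    have hsa := Finset.add_sum_erase s a hx
    have htb := Finset.add_sum_erase t b hy
    rcases le_total (a x) (b y) with hle | hle
    · have hb' : ∀ j, 0 ≤ Function.update b y (b y - a x) j := by
        intro j
        by_cases hj : j = y
        · subst hj; simp [hle]
        · simp [hj, hb]
      have hab' : ∑ i ∈ s.erase x, a i = ∑ j ∈ t, Function.update b y (b y - a x) j := by
        rw [Finset.sum_update_of_mem hy, Finset.sdiff_singleton_eq_erase]
        linarith
      obtain ⟨A, hA, w, w0, wA, wa, wb⟩ :=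
        ih m (n + 1) (by omega) (s.erase x) t hs' ht a _ ha hb' hab'
      have hwx : ∀ j, w (x, j) = 0 := fun j => wA _ fun h => by
        have := Finset.mem_product.1 ((mem_stair.1 hA).1 h)
        simp at this
      have hmem := stair_insert_left (by simp) hy (fun i hi => hxm i (Finset.mem_of_mem_erase hi))
          hym hA (x := x)
      rw [Finset.insert_erase hx] at hmem
      refine ⟨_, hmem, fun p => if p = (x, y) then a x else w p, ?_, ?_, ?_, ?_⟩
      · intro p
        dsimp only
        split_ifs
        exacts [ha _, w0 _]
      · intro p hp
        rw [Finset.mem_insert, not_or] at hp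
        simp only [if_neg hp.1]
        exact wA p hp.2
      · intro i hi
        by_cases hix : i = x
        · subst hix
          simp [hwx, hy]
        · simp only [Prod.mk.injEq, hix, false_and, if_false]
          exact wa i (Finset.mem_erase.2 ⟨hix, hi⟩)
      · intro j hj
        rw [← Finset.add_sum_erase _ _ hx]
        have : ∑ i ∈ s.erase x, (if (i, j) = (x, y) then a x else w (i, j)) =
            ∑ i ∈ s.erase x, w (i, j) := by
          refine Finset.sum_congr rfl fun i hi => ?_
          have := Finset.ne_of_mem_erase hi
          simp [this]
        rw [this, wb j hj]
        by_cases hjy : j = y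
        · subst hjy; simp
        · simp [hjy, hwx]
    · have ha' : ∀ j, 0 ≤ Function.update a x (a x - b y) j := by
        intro j
        by_cases hj : j = x
        · subst hj; simp [hle]
        · simp [hj, ha]
      have hab' : ∑ j ∈ s, Function.update a x (a x - b y) j = ∑ i ∈ t.erase y, b i := by
        rw [Finset.sum_update_of_mem hx, Finset.sdiff_singleton_eq_erase]
        linarith
      obtain ⟨A, hA, w, w0, wA, wa, wb⟩ :=
        ih (m + 1) n (by omega) s (t.erase y) hs ht' _ b ha' hb hab'
      have hwy : ∀ i, w (i, y) = 0 := fun i => wA _ fun h => by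
        have := Finset.mem_product.1 ((mem_stair.1 hA).1 h)
        simp at this
      have hmem := stair_insert_right hx (by simp) hxm
        (fun i hi => hym i (Finset.mem_of_mem_erase hi)) hA (y := y)
      rw [Finset.insert_erase hy] at hmem
      refine ⟨_, hmem, fun p => if p = (x, y) then b y else w p, ?_, ?_, ?_, ?_⟩
      · intro p
        dsimp only
        split_ifs
        exacts [hb _, w0 _]
      · intro p hp
        rw [Finset.mem_insert, not_or] at hp
        simp only [if_neg hp.1]
        exact wA p hp.2
      · intro i hi
        rw [← Finset.add_sum_erase _ _ hy]
        have : ∑ j ∈ t.erase y, (if (i, j) = (x, y) then b y else w (i, j)) =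
            ∑ j ∈ t.erase y, w (i, j) := by
          refine Finset.sum_congr rfl fun j hj => ?_
          have := Finset.ne_of_mem_erase hj
          simp [this]
        rw [this, wa i hi]
        by_cases hix : i = x
        · subst hix; simp
        · simp [hix, hwy]
      · intro j hj
        by_cases hjy : j = y
        · subst hjy
          simp [hwy, hx]
        · simp only [Prod.mk.injEq, hjy, and_false, if_false]
          exact wb j (Finset.mem_erase.2 ⟨hjy, hj⟩)

theorem cdf_zero {u : α → K} {v : β → L} (hu : Function.Injective u) (hv : Function.Injective v)
    (S : Finset (α × β)) (D : α × β → ℝ)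
    (h : ∀ p ∈ S, ∑ q ∈ S, (if u q.1 ≤ u p.1 ∧ v q.2 ≤ v p.2 then D q else 0) = 0) :
    ∀ p ∈ S, D p = 0 := by
  by_contra hcon
  push Not at hcon
  obtain ⟨p0, hp0, hne⟩ := hcon
  obtain ⟨p, hp, hmin⟩ := (S.filter (fun p => D p ≠ 0)).exists_min_image
    (fun p => toLex (u p.1, v p.2)) ⟨p0, by simp [hp0, hne]⟩
  rw [Finset.mem_filter] at hp
  apply hp.2
  rw [← h p hp.1, Finset.sum_eq_single_of_mem p hp.1]
  · simp
  · intro q hq hqp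
    split_ifs with hle
    · by_contra hD
      have h1 := hmin q (by simp [hq, hD])
      have h2 : toLex (u q.1, v q.2) ≤ toLex (u p.1, v p.2) := Prod.Lex.toLex_mono hle
      have h3 := toLex.injective (le_antisymm h1 h2)
      rw [Prod.mk.injEq] at h3
      exact hqp (Prod.ext (hu h3.1).symm (hv h3.2).symm)
    · rfl

theorem cdf_min {u : α → K} {v : β → L} (S : Finset (α × β)) (A : Finset (α × β))
    (hA : ChainK u v A) (W : α × β → ℝ) (W0 : ∀ p, 0 ≤ W p) (WA : ∀ p, p ∉ A → W p = 0)
    (p : α × β) :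
    ∑ q ∈ S, (if u q.1 ≤ u p.1 ∧ v q.2 ≤ v p.2 then W q else 0) =
      min (∑ q ∈ S, (if u q.1 ≤ u p.1 then W q else 0))
        (∑ q ∈ S, (if v q.2 ≤ v p.2 then W q else 0)) := by
  apply le_antisymm
  · apply le_min
    · apply Finset.sum_le_sum
      intro q _
      have := W0 q
      split_ifs <;> simp_all
    · apply Finset.sum_le_sum
      intro q _
      have := W0 q
      split_ifs <;> simp_all
  · by_cases hc : ∀ q ∈ A, u q.1 ≤ u p.1 → v q.2 ≤ v p.2
    · refine (min_le_left _ _).trans (le_of_eq (Finset.sum_congr rfl fun q _ => ?_))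
      by_cases hq : q ∈ A
      · by_cases h1 : u q.1 ≤ u p.1
        · simp [h1, hc q hq h1]
        · simp [h1]
      · simp [WA q hq]
    · push Not at hc
      obtain ⟨r, hr, hr1, hr2⟩ := hc
      refine (min_le_right _ _).trans (le_of_eq (Finset.sum_congr rfl fun q _ => ?_))
      by_cases hq : q ∈ A
      · by_cases h1 : v q.2 ≤ v p.2
        · have : u q.1 ≤ u r.1 := by
            by_contra hlt
            exact absurd (hA r hr q hq (not_le.1 hlt)) (not_le.2 (h1.trans_lt hr2))
          simp [h1, this.trans hr1]
        · simp [h1]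
      · simp [WA q hq]

theorem chain_unique {u : α → K} {v : β → L} (hu : Function.Injective u)
    (hv : Function.Injective v) (S : Finset α) (T : Finset β) (A B : Finset (α × β))
    (hA : ChainK u v A) (hB : ChainK u v B) (W W' : α × β → ℝ)
    (W0 : ∀ p, 0 ≤ W p) (WA : ∀ p, p ∉ A → W p = 0)
    (W0' : ∀ p, 0 ≤ W' p) (WB : ∀ p, p ∉ B → W' p = 0)
    (h1 : ∀ i ∈ S, ∑ j ∈ T, W (i, j) = ∑ j ∈ T, W' (i, j))
    (h2 : ∀ j ∈ T, ∑ i ∈ S, W (i, j) = ∑ i ∈ S, W' (i, j)) :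
    ∀ p ∈ S ×ˢ T, W p = W' p := by
  have key := cdf_zero hu hv (S ×ˢ T) (fun p => W p - W' p) ?_
  · intro p hp
    exact sub_eq_zero.1 (key p hp)
  intro p hp
  have e : ∀ q : α × β, (if u q.1 ≤ u p.1 ∧ v q.2 ≤ v p.2 then W q - W' q else 0) =
      (if u q.1 ≤ u p.1 ∧ v q.2 ≤ v p.2 then W q else 0) -
      (if u q.1 ≤ u p.1 ∧ v q.2 ≤ v p.2 then W' q else 0) := by
    intro q; split_ifs <;> simp
  simp only [e]
  rw [Finset.sum_sub_distrib, cdf_min _ A hA W W0 WA, cdf_min _ B hB W' W0' WB, sub_eq_zero]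
  congr 1
  · rw [Finset.sum_product, Finset.sum_product]
    refine Finset.sum_congr rfl fun i hi => ?_
    by_cases hc : u i ≤ u p.1
    · simp [hc, h1 i hi]
    · simp [hc]
  · rw [Finset.sum_product_right, Finset.sum_product_right]
    refine Finset.sum_congr rfl fun i hi => ?_
    by_cases hc : v i ≤ v p.2
    · simp [hc, h2 i hi]
    · simp [hc]

end Comb

section Tri

variable {E F G H : Type*} [AddCommGroup E] [Module ℝ E] [AddCommGroup F] [Module ℝ F]
  [AddCommGroup G] [Module ℝ G] [AddCommGroup H] [Module ℝ H]

theorem affInd_iff (σ : Finset E) :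
    AffineIndependent ℝ (fun p : (σ : Set E) => (p : E)) ↔
      ∀ w : E → ℝ, ∑ x ∈ σ, w x = 0 → ∑ x ∈ σ, w x • x = 0 → ∀ x ∈ σ, w x = 0 := by
  rw [affineIndependent_iff]
  constructor
  · intro h w h1 h2 x hx
    refine h Finset.univ (fun p => w p) ?_ ?_ ⟨x, hx⟩ (Finset.mem_univ _)
    · rw [← h1]; exact Finset.sum_coe_sort σ w
    · rw [← h2]; exact Finset.sum_coe_sort σ (fun x => w x • x)
  · intro h s w h1 h2 e he
    have key := h (fun x => if hx : x ∈ σ then (if (⟨x, hx⟩ : (σ : Set E)) ∈ s then w ⟨x, hx⟩ else 0)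
      else 0) ?_ ?_ e e.2
    · have : (e : E) ∈ σ := e.2
      simpa [this, he] using key
    · rw [← Finset.sum_coe_sort σ]
      refine Eq.trans ?_ h1
      simp only [Finset.coe_mem, dif_pos]
      exact (Finset.sum_ite_mem Finset.univ s w).trans (by rw [Finset.univ_inter])
    · rw [← Finset.sum_coe_sort σ, ← h2]
      simp only [Finset.coe_mem, dif_pos, ite_smul, zero_smul]
      exact (Finset.sum_ite_mem Finset.univ s (fun e => w e • (e : E))).trans
        (by rw [Finset.univ_inter])

theorem hull_iff {σ V : Finset E} (h : σ ⊆ V) (x : E) :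
    x ∈ convexHull ℝ (σ : Set E) ↔ ∃ w : E → ℝ, (∀ y, 0 ≤ w y) ∧ (∀ y, y ∉ σ → w y = 0) ∧
      ∑ y ∈ V, w y = 1 ∧ ∑ y ∈ V, w y • y = x := by
  rw [Finset.mem_convexHull']
  constructor
  · rintro ⟨w, w0, w1, wx⟩
    refine ⟨fun y => if y ∈ σ then w y else 0, ?_, ?_, ?_, ?_⟩
    · intro y
      dsimp only
      split_ifs with hy
      exacts [w0 y hy, le_rfl]
    · intro y hy
      exact if_neg hy
    · rw [Finset.sum_ite_mem, Finset.inter_eq_right.2 h, w1]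
    · simp only [ite_smul, zero_smul]
      rw [Finset.sum_ite_mem, Finset.inter_eq_right.2 h, wx]
  · rintro ⟨w, w0, ws, w1, wx⟩
    refine ⟨w, fun y _ => w0 y, ?_, ?_⟩
    · rw [← w1]
      exact Finset.sum_subset h fun y _ hy => ws y hy
    · rw [← wx]
      exact Finset.sum_subset h fun y _ hy => by rw [ws y hy, zero_smul]

/-- Triangulation in a general real vector space (without the redundant interior clause). -/
def Tri (n : ℕ) (V : Finset E) (T : Finset (Finset E)) : Prop :=
  (∀ σ ∈ T, σ.card = n + 1 ∧ AffineIndependent ℝ (fun p : (σ : Set E) => (p : E)) ∧ σ ⊆ V) ∧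
  (⋃ σ ∈ T, convexHull ℝ (σ : Set E)) = convexHull ℝ (V : Set E) ∧
  (∀ σ ∈ T, ∀ τ ∈ T, convexHull ℝ (σ : Set E) ∩ convexHull ℝ (τ : Set E) =
    convexHull ℝ ((σ : Set E) ∩ (τ : Set E)))

theorem aff_unique {σ V : Finset E} (h : σ ⊆ V)
    (hσ : AffineIndependent ℝ (fun p : (σ : Set E) => (p : E))) (w w' : E → ℝ)
    (hw : ∀ y, y ∉ σ → w y = 0) (hw' : ∀ y, y ∉ σ → w' y = 0)
    (h1 : ∑ y ∈ V, w y = ∑ y ∈ V, w' y) (h2 : ∑ y ∈ V, w y • y = ∑ y ∈ V, w' y • y) : w = w' := by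
  rw [affInd_iff] at hσ
  have key := hσ (fun y => w y - w' y) ?_ ?_
  · funext y
    by_cases hy : y ∈ σ
    · exact sub_eq_zero.1 (key y hy)
    · rw [hw y hy, hw' y hy]
  · rw [Finset.sum_subset h fun y _ hy => by rw [hw y hy, hw' y hy, sub_zero],
      Finset.sum_sub_distrib, h1, sub_self]
  · rw [Finset.sum_subset h fun y _ hy => by rw [hw y hy, hw' y hy, sub_zero, zero_smul]]
    simp only [sub_smul]
    rw [Finset.sum_sub_distrib, h2, sub_self]

theorem Tri.unique {n : ℕ} {V : Finset E} {T : Finset (Finset E)} (hT : Tri n V T)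
    {σ τ : Finset E} (hσ : σ ∈ T) (hτ : τ ∈ T) (w w' : E → ℝ)
    (w0 : ∀ y, 0 ≤ w y) (w0' : ∀ y, 0 ≤ w' y)
    (hw : ∀ y, y ∉ σ → w y = 0) (hw' : ∀ y, y ∉ τ → w' y = 0)
    (h1 : ∑ y ∈ V, w y = 1) (h1' : ∑ y ∈ V, w' y = 1)
    (h2 : ∑ y ∈ V, w y • y = ∑ y ∈ V, w' y • y) : w = w' := by
  obtain ⟨hs, -, hi⟩ := hT
  have hx1 : ∑ y ∈ V, w y • y ∈ convexHull ℝ (σ : Set E) :=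
    (hull_iff (hs σ hσ).2.2 _).2 ⟨w, w0, hw, h1, rfl⟩
  have hx2 : ∑ y ∈ V, w y • y ∈ convexHull ℝ (τ : Set E) :=
    (hull_iff (hs τ hτ).2.2 _).2 ⟨w', w0', hw', h1', h2.symm⟩
  have hx : ∑ y ∈ V, w y • y ∈ convexHull ℝ ((σ : Set E) ∩ (τ : Set E)) := by
    rw [← hi σ hσ τ hτ]; exact ⟨hx1, hx2⟩
  rw [← Finset.coe_inter, hull_iff (Finset.inter_subset_left.trans (hs σ hσ).2.2)] at hx
  obtain ⟨w3, w30, w3s, w31, w3x⟩ := hx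
  have e1 := aff_unique (hs σ hσ).2.2 (hs σ hσ).2.1 w w3 hw
    (fun y hy => w3s y fun h => hy (Finset.mem_inter.1 h).1) (by rw [h1, w31]) w3x.symm
  have e2 := aff_unique (hs τ hτ).2.2 (hs τ hτ).2.1 w' w3 hw'
    (fun y hy => w3s y fun h => hy (Finset.mem_inter.1 h).2) (by rw [h1', w31])
    (by rw [← h2, w3x])
  rw [e1, e2]

variable {K L : Type*} [LinearOrder K] [LinearOrder L]

/-- The staircase refinement of the product of two triangulations. -/
def prodTri (u : E → K) (v : F → L) (T : Finset (Finset E)) (U : Finset (Finset F)) :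
    Finset (Finset (E × F)) :=
  (T ×ˢ U).biUnion (fun st => Stair u v st.1 st.2)

theorem mem_prodTri {u : E → K} {v : F → L} {T : Finset (Finset E)} {U : Finset (Finset F)}
    {A : Finset (E × F)} :
    A ∈ prodTri u v T U ↔ ∃ σ ∈ T, ∃ τ ∈ U, A ∈ Stair u v σ τ := by
  simp only [prodTri, Finset.mem_biUnion, Finset.mem_product, Prod.exists]
  constructor
  · rintro ⟨σ, τ, ⟨h1, h2⟩, h⟩; exact ⟨σ, h1, τ, h2, h⟩
  · rintro ⟨σ, h1, τ, h2, h⟩; exact ⟨σ, τ, ⟨h1, h2⟩, h⟩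

theorem prodTri_card (u : E → K) (v : F → L) {n m : ℕ} {V : Finset E} {T : Finset (Finset E)}
    {W : Finset F} {U : Finset (Finset F)} (hT : Tri n V T) (hU : Tri m W U) :
    T.card * U.card * (n + m).choose n ≤ (prodTri u v T U).card := by
  rw [prodTri, Finset.card_biUnion]
  · rw [← Finset.card_product, ← smul_eq_mul]
    apply Finset.card_nsmul_le_sum
    rintro ⟨σ, τ⟩ h
    rw [Finset.mem_product] at h
    exact stair_count u v (n + m) n m rfl σ τ (hT.1 σ h.1).1 (hU.1 τ h.2).1
  · rintro ⟨σ, τ⟩ h ⟨σ', τ'⟩ h' hne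
    rw [Function.onFun, Finset.disjoint_left]
    intro A hA hB
    have h1 := (mem_stair.1 hA).2.2.2
    have h2 := (mem_stair.1 hB).2.2.2
    exact hne (Prod.ext (h1.1.symm.trans h2.1) (h1.2.symm.trans h2.2))

theorem fst_sum (V : Finset E) (W : Finset F) (w : E × F → ℝ) :
    (∑ p ∈ V ×ˢ W, w p • p).1 = ∑ x ∈ V, (∑ y ∈ W, w (x, y)) • x := by
  rw [Prod.fst_sum, Finset.sum_product]
  refine Finset.sum_congr rfl fun x _ => ?_
  rw [Finset.sum_smul]
  rfl

theorem snd_sum (V : Finset E) (W : Finset F) (w : E × F → ℝ) :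
    (∑ p ∈ V ×ˢ W, w p • p).2 = ∑ y ∈ W, (∑ x ∈ V, w (x, y)) • y := by
  rw [Prod.snd_sum, Finset.sum_product_right]
  refine Finset.sum_congr rfl fun x _ => ?_
  rw [Finset.sum_smul]
  rfl

theorem stair_affInd {u : E → K} {v : F → L} (hu : Function.Injective u)
    (hv : Function.Injective v) {σ : Finset E} {τ : Finset F}
    (hσ : AffineIndependent ℝ (fun p : (σ : Set E) => (p : E)))
    (hτ : AffineIndependent ℝ (fun p : (τ : Set F) => (p : F)))
    {A : Finset (E × F)} (hA : A ∈ Stair u v σ τ) :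
    AffineIndependent ℝ (fun p : (A : Set (E × F)) => (p : E × F)) := by
  rw [affInd_iff] at hσ hτ ⊢
  obtain ⟨hsub, hch, -⟩ := mem_stair.1 hA
  intro w h1 h2
  set W : E × F → ℝ := fun p => if p ∈ A then w p else 0 with hW
  have e1 : ∑ p ∈ σ ×ˢ τ, W p = 0 := by
    rw [hW, Finset.sum_ite_mem, Finset.inter_eq_right.2 hsub, h1]
  have e2 : ∑ p ∈ σ ×ˢ τ, W p • p = 0 := by
    simp only [hW, ite_smul, zero_smul]
    rw [Finset.sum_ite_mem, Finset.inter_eq_right.2 hsub, h2]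
  have ha := hσ (fun x => ∑ y ∈ τ, W (x, y)) (by rw [← Finset.sum_product, e1])
    (by rw [← fst_sum, e2]; rfl)
  have hb := hτ (fun y => ∑ x ∈ σ, W (x, y)) (by rw [← Finset.sum_product_right, e1])
    (by rw [← snd_sum, e2]; rfl)
  have hd : ∀ p, max (W p) 0 - max (-W p) 0 = W p := by
    intro p
    rcases le_total (W p) 0 with h | h
    · rw [max_eq_right h, max_eq_left (by linarith)]; ring
    · rw [max_eq_left h, max_eq_right (by linarith)]; ring
  have key := chain_unique hu hv σ τ A A hch hch (fun p => max (W p) 0) (fun p => max (-W p) 0)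
    (fun p => le_max_right _ _) (fun p hp => by simp [hW, hp])
    (fun p => le_max_right _ _) (fun p hp => by simp [hW, hp])
    (fun i hi => by
      rw [← sub_eq_zero, ← Finset.sum_sub_distrib]; simp only [hd]; exact ha i hi)
    (fun i hi => by
      rw [← sub_eq_zero, ← Finset.sum_sub_distrib]; simp only [hd]; exact hb i hi)
  intro p hp
  have h3 : max (W p) 0 = max (-W p) 0 := key p (hsub hp)
  have h4 := hd p
  rw [h3, sub_self] at h4
  simpa [hW, hp] using h4.symm

theorem Tri.prod {u : E → K} {v : F → L} (hu : Function.Injective u)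
    (hv : Function.Injective v) {n m : ℕ} {V : Finset E} {T : Finset (Finset E)}
    {W : Finset F} {U : Finset (Finset F)} (hT : Tri n V T) (hU : Tri m W U) :
    Tri (n + m) (V ×ˢ W) (prodTri u v T U) := by
  have hsub : ∀ σ ∈ T, ∀ τ ∈ U, ∀ A ∈ Stair u v σ τ, A ⊆ V ×ˢ W := by
    intro σ hσ τ hτ A hA
    exact (mem_stair.1 hA).1.trans (Finset.product_subset_product (hT.1 σ hσ).2.2 (hU.1 τ hτ).2.2)
  refine ⟨?_, ?_, ?_⟩
  · intro A hA
    obtain ⟨σ, hσ, τ, hτ, hA⟩ := mem_prodTri.1 hA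
    refine ⟨?_, stair_affInd hu hv (hT.1 σ hσ).2.1 (hU.1 τ hτ).2.1 hA, hsub σ hσ τ hτ A hA⟩
    have := (mem_stair.1 hA).2.2.1
    rw [(hT.1 σ hσ).1, (hU.1 τ hτ).1] at this
    omega
  · apply Set.Subset.antisymm
    · apply Set.iUnion₂_subset
      intro A hA
      obtain ⟨σ, hσ, τ, hτ, hA⟩ := mem_prodTri.1 hA
      exact convexHull_mono (Finset.coe_subset.2 (hsub σ hσ τ hτ A hA))
    · rintro ⟨x, y⟩ hp
      rw [Finset.coe_product, convexHull_prod] at hp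
      obtain ⟨hx, hy⟩ := hp
      rw [← hT.2.1, Set.mem_iUnion₂] at hx
      rw [← hU.2.1, Set.mem_iUnion₂] at hy
      obtain ⟨σ, hσ, hx⟩ := hx
      obtain ⟨τ, hτ, hy⟩ := hy
      rw [hull_iff subset_rfl] at hx hy
      obtain ⟨a, a0, -, a1, ax⟩ := hx
      obtain ⟨b, b0, -, b1, bx⟩ := hy
      simp only at ax bx
      obtain ⟨A, hA, w, w0, wA, wa, wb⟩ := stair_cover u v (n + m) n m rfl σ τ (hT.1 σ hσ).1
        (hU.1 τ hτ).1 a b a0 b0 (by rw [a1, b1])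
      rw [Set.mem_iUnion₂]
      refine ⟨A, mem_prodTri.2 ⟨σ, hσ, τ, hτ, hA⟩, ?_⟩
      rw [hull_iff (mem_stair.1 hA).1]
      refine ⟨w, w0, wA, ?_, ?_⟩
      · rw [Finset.sum_product, Finset.sum_congr rfl wa, a1]
      · apply Prod.ext
        · rw [fst_sum, ← ax]
          exact Finset.sum_congr rfl fun i hi => by rw [wa i hi]
        · rw [snd_sum, ← bx]
          exact Finset.sum_congr rfl fun i hi => by rw [wb i hi]
  · intro A hA B hB
    obtain ⟨σ, hσ, τ, hτ, hA⟩ := mem_prodTri.1 hA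
    obtain ⟨σ', hσ', τ', hτ', hB⟩ := mem_prodTri.1 hB
    have sA := hsub σ hσ τ hτ A hA
    have sB := hsub σ' hσ' τ' hτ' B hB
    apply Set.Subset.antisymm
    · rintro p ⟨hp, hq⟩
      rw [hull_iff sA] at hp
      rw [hull_iff sB] at hq
      obtain ⟨w, w0, wA, w1, wx⟩ := hp
      obtain ⟨z, z0, zB, z1, zx⟩ := hq
      have h1 := hT.unique hσ hσ' (fun x => ∑ y ∈ W, w (x, y)) (fun x => ∑ y ∈ W, z (x, y))
        (fun x => Finset.sum_nonneg fun y _ => w0 _) (fun x => Finset.sum_nonneg fun y _ => z0 _)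
        (fun x hx => Finset.sum_eq_zero fun y _ => wA _ fun h =>
          hx (Finset.mem_product.1 ((mem_stair.1 hA).1 h)).1)
        (fun x hx => Finset.sum_eq_zero fun y _ => zB _ fun h =>
          hx (Finset.mem_product.1 ((mem_stair.1 hB).1 h)).1)
        (by rw [← Finset.sum_product, w1]) (by rw [← Finset.sum_product, z1])
        (by rw [← fst_sum, ← fst_sum, wx, zx])
      have h2 := hU.unique hτ hτ' (fun y => ∑ x ∈ V, w (x, y)) (fun y => ∑ x ∈ V, z (x, y))
        (fun x => Finset.sum_nonneg fun y _ => w0 _) (fun x => Finset.sum_nonneg fun y _ => z0 _)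
        (fun x hx => Finset.sum_eq_zero fun y _ => wA _ fun h =>
          hx (Finset.mem_product.1 ((mem_stair.1 hA).1 h)).2)
        (fun x hx => Finset.sum_eq_zero fun y _ => zB _ fun h =>
          hx (Finset.mem_product.1 ((mem_stair.1 hB).1 h)).2)
        (by rw [← Finset.sum_product_right, w1]) (by rw [← Finset.sum_product_right, z1])
        (by rw [← snd_sum, ← snd_sum, wx, zx])
      have key := chain_unique hu hv V W A B (mem_stair.1 hA).2.1 (mem_stair.1 hB).2.1 w z
        w0 wA z0 zB (fun i _ => congrFun h1 i) (fun i _ => congrFun h2 i)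
      rw [← Finset.coe_inter, hull_iff (Finset.inter_subset_left.trans sA)]
      refine ⟨w, w0, ?_, w1, wx⟩
      intro q hq
      by_cases hqA : q ∈ A
      · rw [key q (sA hqA)]
        exact zB q fun h => hq (Finset.mem_inter.2 ⟨hqA, h⟩)
      · exact wA q hqA
    · exact Set.subset_inter (convexHull_mono Set.inter_subset_left)
        (convexHull_mono Set.inter_subset_right)

theorem hull_image (Λ : G ≃ₗ[ℝ] H) (S : Set G) :
    convexHull ℝ (Λ '' S) = Λ '' convexHull ℝ S :=
  (LinearMap.image_convexHull Λ.toLinearMap S).symm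

theorem Tri.map (Λ : G ≃ₗ[ℝ] H) {n : ℕ} {V : Finset G} {T : Finset (Finset G)}
    (hT : Tri n V T) : Tri n (V.image Λ) (T.image (Finset.image Λ)) := by
  refine ⟨?_, ?_, ?_⟩
  · intro σ' hσ'
    obtain ⟨σ, hσ, rfl⟩ := Finset.mem_image.1 hσ'
    obtain ⟨h1, h2, h3⟩ := hT.1 σ hσ
    refine ⟨?_, ?_, Finset.image_subset_image h3⟩
    · rw [Finset.card_image_of_injective _ Λ.injective, h1]
    · rw [affInd_iff] at h2 ⊢
      intro w w1 w2 y hy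
      obtain ⟨x, hx, rfl⟩ := Finset.mem_image.1 hy
      rw [Finset.sum_image (fun _ _ _ _ h => Λ.injective h)] at w1 w2
      refine h2 (fun x => w (Λ x)) w1 ?_ x hx
      apply Λ.injective
      rw [map_sum, map_zero, ← w2]
      exact Finset.sum_congr rfl fun i _ => map_smul _ _ _
  · rw [Finset.coe_image, hull_image, ← hT.2.1, Set.image_iUnion₂, Finset.set_biUnion_finset_image]
    simp only [Finset.coe_image, hull_image]
  · intro σ' hσ' τ' hτ'
    obtain ⟨σ, hσ, rfl⟩ := Finset.mem_image.1 hσ'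
    obtain ⟨τ, hτ, rfl⟩ := Finset.mem_image.1 hτ'
    rw [Finset.coe_image, Finset.coe_image, ← Set.image_inter Λ.injective, hull_image, hull_image,
      hull_image, ← Set.image_inter Λ.injective, hT.2.2 σ hσ τ hτ]

end Tri

theorem tri_of {d : ℕ} {V : Finset (PtD d)} {T : Finset (Finset (PtD d))}
    (h : IsTriangulationD d V T) : Tri d V T := by
  obtain ⟨h1, -, h3, h4⟩ := h
  refine ⟨fun σ hσ => ⟨(h1 σ hσ).1.1, (h1 σ hσ).1.2, Finset.coe_subset.1 (h1 σ hσ).2⟩, h3, ?_⟩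
  intro σ hσ τ hτ
  rw [h4 σ hσ τ hτ, Finset.coe_inter]

theorem of_tri {d : ℕ} {V : Finset (PtD d)} {T : Finset (Finset (PtD d))}
    (h : Tri d V T) : IsTriangulationD d V T := by
  obtain ⟨h1, h3, h4⟩ := h
  refine ⟨fun σ hσ => ⟨⟨(h1 σ hσ).1, (h1 σ hσ).2.1⟩, Finset.coe_subset.2 (h1 σ hσ).2.2⟩, ?_, h3, ?_⟩
  · intro σ hσ τ hτ hne
    rw [← interior_inter, h4 σ hσ τ hτ]
    by_contra hcon
    have hne' := Set.nonempty_iff_ne_empty.2 hcon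
    rw [interior_convexHull_nonempty_iff_affineSpan_eq_top, ← Finset.coe_inter] at hne'
    have hlt : (σ ∩ τ).card < d + 1 := by
      rw [← (h1 σ hσ).1]
      apply Finset.card_lt_card
      refine Finset.ssubset_iff_subset_ne.2 ⟨Finset.inter_subset_left, fun he => hne ?_⟩
      apply Finset.eq_of_subset_of_card_le (Finset.inter_eq_left.1 he)
      rw [(h1 σ hσ).1, (h1 τ hτ).1]
    have hpos : (σ ∩ τ).Nonempty := by
      by_contra hemp
      rw [Finset.not_nonempty_iff_eq_empty] at hemp
      rw [hemp, Finset.coe_empty, AffineSubspace.span_empty] at hne'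
      exact AffineSubspace.bot_ne_top _ _ _ hne'
    have hdim := finrank_vectorSpan_image_finset_le ℝ (id : PtD d → PtD d) (σ ∩ τ)
      (n := (σ ∩ τ).card - 1) (by have := hpos.card_pos; omega)
    rw [Finset.image_id, ← direction_affineSpan, hne', AffineSubspace.direction_top,
      finrank_top] at hdim
    simp at hdim
    have := hpos.card_pos
    omega
  · intro σ hσ τ hτ
    rw [h4 σ hσ τ hτ, Finset.coe_inter]

section Cube

variable {E F G H : Type*} [AddCommGroup E] [Module ℝ E] [AddCommGroup F] [Module ℝ F]
  [AddCommGroup G] [Module ℝ G] [AddCommGroup H] [Module ℝ H]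

/-- Points of `V` are in convex position. -/
def ConvPos (V : Set E) : Prop := ∀ x ∈ V, x ∈ (convexHull ℝ V).extremePoints ℝ

/-- Combinatorial equivalence of vertex sets. -/
def CombIso (V : Set E) (W : Set F) : Prop :=
  ∃ ψ : E → F, Set.BijOn ψ V W ∧ ∀ S ⊆ V,
    (IsExtreme ℝ (convexHull ℝ V) (convexHull ℝ S) ↔
      IsExtreme ℝ (convexHull ℝ W) (convexHull ℝ (ψ '' S)))

theorem CombIso.convPos {V : Set E} {W : Set F} (h : CombIso V W) (hV : ConvPos V) :
    ConvPos W := by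
  obtain ⟨ψ, hψ, he⟩ := h
  intro y hy
  obtain ⟨x, hx, rfl⟩ := hψ.surjOn hy
  have := (he {x} (by simpa using hx)).1 (by
    rw [convexHull_singleton, isExtreme_singleton]; exact hV x hx)
  rwa [Set.image_singleton, convexHull_singleton, isExtreme_singleton] at this

theorem extreme_prod_iff {A : Set E} {B : Set F} {C : Set E} {D : Set F}
    (hC : C.Nonempty) (hD : D.Nonempty) :
    IsExtreme ℝ (A ×ˢ B) (C ×ˢ D) ↔ IsExtreme ℝ A C ∧ IsExtreme ℝ B D := by
  obtain ⟨c, hc⟩ := hC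
  obtain ⟨d, hd⟩ := hD
  constructor
  · intro h
    have hcA : c ∈ A := (h.1 (Set.mk_mem_prod hc hd)).1
    have hdB : d ∈ B := (h.1 (Set.mk_mem_prod hc hd)).2
    refine ⟨⟨fun x hx => (h.1 (Set.mk_mem_prod hx hd)).1, ?_⟩,
      ⟨fun y hy => (h.1 (Set.mk_mem_prod hc hy)).2, ?_⟩⟩
    · intro x hx y hy z hz hxyz
      refine (h.2 (Set.mk_mem_prod hx hdB) (Set.mk_mem_prod hy hdB) (Set.mk_mem_prod hz hd) ?_).1
      obtain ⟨a, b, ha, hb, hab, rfl⟩ := hxyz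
      refine ⟨a, b, ha, hb, hab, ?_⟩
      simp [← add_smul, hab]
    · intro x hx y hy z hz hxyz
      refine (h.2 (Set.mk_mem_prod hcA hx) (Set.mk_mem_prod hcA hy) (Set.mk_mem_prod hc hz) ?_).2
      obtain ⟨a, b, ha, hb, hab, rfl⟩ := hxyz
      refine ⟨a, b, ha, hb, hab, ?_⟩
      simp [← add_smul, hab]
  · rintro ⟨h1, h2⟩
    refine ⟨Set.prod_mono h1.1 h2.1, ?_⟩
    rintro x hx y hy z hz ⟨a, b, ha, hb, hab, rfl⟩
    exact ⟨h1.2 hx.1 hy.1 hz.1 ⟨a, b, ha, hb, hab, rfl⟩,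
      h2.2 hx.2 hy.2 hz.2 ⟨a, b, ha, hb, hab, rfl⟩⟩

theorem ConvPos.prod {V : Set E} {W : Set F} (hV : ConvPos V) (hW : ConvPos W) :
    ConvPos (V ×ˢ W) := by
  rintro ⟨x, y⟩ ⟨hx, hy⟩
  rw [← isExtreme_singleton, convexHull_prod, ← Set.singleton_prod_singleton,
    extreme_prod_iff (by simp) (by simp), isExtreme_singleton, isExtreme_singleton]
  exact ⟨hV x hx, hW y hy⟩

theorem extreme_hull_prod_iff {V : Set E} {W : Set F} (hV : ConvPos V) (hW : ConvPos W)
    {S : Set (E × F)} (hS : S ⊆ V ×ˢ W) (hne : S.Nonempty) :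
    IsExtreme ℝ (convexHull ℝ (V ×ˢ W)) (convexHull ℝ S) ↔
      S = (Prod.fst '' S) ×ˢ (Prod.snd '' S) ∧
      IsExtreme ℝ (convexHull ℝ V) (convexHull ℝ (Prod.fst '' S)) ∧
      IsExtreme ℝ (convexHull ℝ W) (convexHull ℝ (Prod.snd '' S)) := by
  have main : IsExtreme ℝ (convexHull ℝ (V ×ˢ W)) (convexHull ℝ S) →
      S = (Prod.fst '' S) ×ˢ (Prod.snd '' S) := by
    intro h
    apply Set.Subset.antisymm
    · intro p hp
      exact ⟨⟨p, hp, rfl⟩, ⟨p, hp, rfl⟩⟩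
    · rintro ⟨x, y⟩ ⟨⟨⟨x1, y'⟩, hp, hx⟩, ⟨⟨x', y1⟩, hq, hy⟩⟩
      simp only at hx hy
      subst hx hy
      have hxy : (x1, y1) ∈ V ×ˢ W := ⟨(hS hp).1, (hS hq).2⟩
      have hxy' : (x', y') ∈ V ×ˢ W := ⟨(hS hq).1, (hS hp).2⟩
      have hmid : ((1:ℝ)/2) • ((x1, y') : E × F) + ((1:ℝ)/2) • ((x', y1) : E × F) ∈
          convexHull ℝ S :=
        (convex_convexHull ℝ S) (subset_convexHull ℝ S hp) (subset_convexHull ℝ S hq)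
          (by norm_num) (by norm_num) (by norm_num)
      have hin : ((x1, y1) : E × F) ∈ convexHull ℝ S := by
        refine h.2 (subset_convexHull ℝ _ hxy) (subset_convexHull ℝ _ hxy') hmid
          ⟨1/2, 1/2, by norm_num, by norm_num, by norm_num, ?_⟩
        apply Prod.ext
        · simp
        · simp [add_comm]
      exact extremePoints_convexHull_subset
        (inter_extremePoints_subset_extremePoints_of_subset h.1 ⟨hin, hV.prod hW _ hxy⟩)
  have iff2 : S = (Prod.fst '' S) ×ˢ (Prod.snd '' S) →
      (IsExtreme ℝ (convexHull ℝ (V ×ˢ W)) (convexHull ℝ S) ↔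
      IsExtreme ℝ (convexHull ℝ V) (convexHull ℝ (Prod.fst '' S)) ∧
      IsExtreme ℝ (convexHull ℝ W) (convexHull ℝ (Prod.snd '' S))) := by
    intro h
    have : convexHull ℝ S = convexHull ℝ (Prod.fst '' S) ×ˢ convexHull ℝ (Prod.snd '' S) := by
      rw [← convexHull_prod, ← h]
    rw [this, convexHull_prod, extreme_prod_iff]
    · exact (hne.image _).convexHull
    · exact (hne.image _).convexHull
  exact ⟨fun h => ⟨main h, (iff2 (main h)).1 h⟩, fun h => (iff2 h.1).2 h.2⟩

theorem CombIso.prod {V : Set E} {V' : Set F} {W : Set G} {W' : Set H}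
    (h : CombIso V W) (h' : CombIso V' W') (hV : ConvPos V) (hV' : ConvPos V') :
    CombIso (V ×ˢ V') (W ×ˢ W') := by
  have hW := h.convPos hV
  have hW' := h'.convPos hV'
  obtain ⟨ψ, hψ, he⟩ := h
  obtain ⟨φ, hφ, he'⟩ := h'
  have hbij : Set.BijOn (Prod.map ψ φ) (V ×ˢ V') (W ×ˢ W') := by
    refine ⟨?_, ?_, ?_⟩
    · rintro ⟨x, y⟩ ⟨hx, hy⟩
      exact ⟨hψ.mapsTo hx, hφ.mapsTo hy⟩
    · rintro ⟨x, y⟩ ⟨hx, hy⟩ ⟨x', y'⟩ ⟨hx', hy'⟩ heq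
      simp only [Prod.map_apply, Prod.mk.injEq] at heq
      exact Prod.ext (hψ.injOn hx hx' heq.1) (hφ.injOn hy hy' heq.2)
    · rintro ⟨x, y⟩ ⟨hx, hy⟩
      obtain ⟨a, ha, rfl⟩ := hψ.surjOn hx
      obtain ⟨b, hb, rfl⟩ := hφ.surjOn hy
      exact ⟨(a, b), ⟨ha, hb⟩, rfl⟩
  refine ⟨Prod.map ψ φ, hbij, ?_⟩
  intro S hS
  rcases S.eq_empty_or_nonempty with rfl | hne
  · simp only [Set.image_empty, convexHull_empty]
    exact ⟨fun _ => ⟨Set.empty_subset _, by simp⟩, fun _ => ⟨Set.empty_subset _, by simp⟩⟩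
  have hS' : Prod.map ψ φ '' S ⊆ W ×ˢ W' := by
    rintro _ ⟨p, hp, rfl⟩
    exact hbij.mapsTo (hS hp)
  rw [extreme_hull_prod_iff hV hV' hS hne, extreme_hull_prod_iff hW hW' hS' (hne.image _)]
  have e1 : Prod.fst '' (Prod.map ψ φ '' S) = ψ '' (Prod.fst '' S) := by
    rw [Set.image_image, Set.image_image]; rfl
  have e2 : Prod.snd '' (Prod.map ψ φ '' S) = φ '' (Prod.snd '' S) := by
    rw [Set.image_image, Set.image_image]; rfl
  have s1 : Prod.fst '' S ⊆ V := by
    rintro _ ⟨p, hp, rfl⟩; exact (hS hp).1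
  have s2 : Prod.snd '' S ⊆ V' := by
    rintro _ ⟨p, hp, rfl⟩; exact (hS hp).2
  rw [e1, e2, ← he _ s1, ← he' _ s2, ← Set.prodMap_image_prod ψ φ,
    hbij.injOn.image_eq_image_iff hS (Set.prod_mono s1 s2)]

theorem extreme_map (Λ : G ≃ₗ[ℝ] H) (A B : Set G) :
    IsExtreme ℝ (Λ '' A) (Λ '' B) ↔ IsExtreme ℝ A B := by
  have hmem : ∀ (C : Set G) (x : G), Λ x ∈ Λ '' C ↔ x ∈ C :=
    fun C x => Λ.injective.mem_set_image
  constructor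
  · intro h
    refine ⟨fun x hx => (hmem A x).1 (h.1 ((hmem B x).2 hx)), ?_⟩
    rintro x hx y hy z hz ⟨a, b, ha, hb, hab, rfl⟩
    refine (hmem B x).1 (h.2 ((hmem A x).2 hx) ((hmem A y).2 hy) ((hmem B _).2 hz)
      ⟨a, b, ha, hb, hab, ?_⟩)
    simp
  · intro h
    refine ⟨Set.image_mono h.1, ?_⟩
    rintro _ ⟨x, hx, rfl⟩ _ ⟨y, hy, rfl⟩ _ ⟨z, hz, rfl⟩ ⟨a, b, ha, hb, hab, he⟩
    refine (hmem B x).2 (h.2 hx hy hz ⟨a, b, ha, hb, hab, Λ.injective ?_⟩)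
    simpa using he

theorem CombIso.map (Λ : E ≃ₗ[ℝ] G) (Γ : F ≃ₗ[ℝ] H) {V : Set E} {W : Set F} (h : CombIso V W) :
    CombIso (Λ '' V) (Γ '' W) := by
  obtain ⟨ψ, hψ, he⟩ := h
  refine ⟨fun x => Γ (ψ (Λ.symm x)), ?_, ?_⟩
  · refine ⟨?_, ?_, ?_⟩
    · rintro _ ⟨x, hx, rfl⟩
      simpa using hψ.mapsTo hx
    · rintro _ ⟨x, hx, rfl⟩ _ ⟨y, hy, rfl⟩ hxy
      simp only [LinearEquiv.symm_apply_apply] at hxy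
      rw [hψ.injOn hx hy (Γ.injective hxy)]
    · rintro _ ⟨y, hy, rfl⟩
      obtain ⟨x, hx, rfl⟩ := hψ.surjOn hy
      exact ⟨Λ x, ⟨x, hx, rfl⟩, by simp⟩
  · intro S hS
    obtain ⟨S, hSV, rfl⟩ := Set.subset_image_iff.1 hS
    have : (fun x => Γ (ψ (Λ.symm x))) '' (Λ '' S) = Γ '' (ψ '' S) := by
      rw [Set.image_image, Set.image_image]; simp
    rw [this, hull_image, hull_image, hull_image, hull_image, extreme_map, extreme_map]
    exact he S hSV

end Cube

theorem mem_stdCube {d : ℕ} {x : PtD d} : x ∈ stdCubeVerts d ↔ ∀ i, x i = 0 ∨ x i = 1 := by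
  simp only [stdCubeVerts, Finset.mem_image, Finset.mem_univ, true_and]
  constructor
  · rintro ⟨b, rfl⟩ i
    by_cases h : b i <;> simp [h]
  · intro h
    refine ⟨fun i => decide (x i = 1), ?_⟩
    funext i
    rcases h i with h | h <;> simp [h]

theorem stdCube_convPos (d : ℕ) : ConvPos (stdCubeVerts d : Set (PtD d)) := by
  have hb : convexHull ℝ (stdCubeVerts d : Set (PtD d)) ⊆ Set.Icc 0 1 := by
    apply convexHull_min _ (convex_Icc _ _)
    intro x hx
    have hx := mem_stdCube.1 hx
    constructor
    · intro i; rcases hx i with h | h <;> simp [h]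
    · intro i; rcases hx i with h | h <;> simp [h]
  intro x hx
  refine ⟨subset_convexHull ℝ _ hx, ?_⟩
  rintro y hy z hz ⟨a, b, ha, hb', hab, he⟩
  have hy := hb hy
  have hz := hb hz
  funext i
  have hi := congrFun he i
  simp only [Pi.add_apply, Pi.smul_apply, smul_eq_mul] at hi
  have y0 := hy.1 i
  have y1 := hy.2 i
  have z0 := hz.1 i
  have z1 := hz.2 i
  simp only [Pi.zero_apply, Pi.one_apply] at y0 y1 z0 z1
  rcases mem_stdCube.1 hx i with h | h
  · rw [h] at hi ⊢
    nlinarith [mul_nonneg ha.le y0, mul_nonneg hb'.le z0]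
  · rw [h] at hi ⊢
    nlinarith [mul_nonneg ha.le (sub_nonneg.2 y1), mul_nonneg hb'.le (sub_nonneg.2 z1)]

/-- `Fin.append` as a linear equivalence. -/
def appL (m n : ℕ) : (PtD m × PtD n) ≃ₗ[ℝ] PtD (m + n) :=
  { Fin.appendEquiv m n with
    map_add' := by
      rintro ⟨x, y⟩ ⟨x', y'⟩
      funext i
      refine Fin.addCases (fun i => ?_) (fun i => ?_) i <;> simp [Fin.appendEquiv]
    map_smul' := by
      rintro c ⟨x, y⟩
      funext i
      refine Fin.addCases (fun i => ?_) (fun i => ?_) i <;> simp [Fin.appendEquiv] }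

theorem appL_apply {m n : ℕ} (x : PtD m) (y : PtD n) : appL m n (x, y) = Fin.append x y := rfl

theorem stdCube_append (m n : ℕ) :
    appL m n '' ((stdCubeVerts m : Set (PtD m)) ×ˢ (stdCubeVerts n : Set (PtD n))) =
      (stdCubeVerts (m + n) : Set (PtD (m + n))) := by
  have key : ∀ x y, appL m n (x, y) ∈ (stdCubeVerts (m + n) : Set (PtD (m + n))) ↔
      x ∈ stdCubeVerts m ∧ y ∈ stdCubeVerts n := by
    intro x y
    rw [Finset.mem_coe, mem_stdCube, mem_stdCube, mem_stdCube, appL_apply]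
    constructor
    · intro h
      exact ⟨fun i => by simpa using h (Fin.castAdd n i), fun i => by simpa using h (Fin.natAdd m i)⟩
    · rintro ⟨h1, h2⟩ i
      refine Fin.addCases (fun i => ?_) (fun i => ?_) i
      · simpa using h1 i
      · simpa using h2 i
  ext z
  constructor
  · rintro ⟨⟨x, y⟩, hxy, rfl⟩
    exact (key x y).2 hxy
  · intro hz
    obtain ⟨⟨x, y⟩, rfl⟩ := (appL m n).surjective z
    exact ⟨(x, y), (key x y).1 hz, rfl⟩

theorem prod_bound {m n : ℕ} {V : Finset (PtD m)} {T : Finset (Finset (PtD m))}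
    {W : Finset (PtD n)} {U : Finset (Finset (PtD n))}
    (hV : IsCombCube m V) (hT : IsTriangulationD m V T)
    (hW : IsCombCube n W) (hU : IsTriangulationD n W U) :
    ∃ X Y, IsCombCube (m + n) X ∧ IsTriangulationD (m + n) X Y ∧
      T.card * U.card * (m + n).choose m ≤ Y.card := by
  have hV' : CombIso (stdCubeVerts m : Set (PtD m)) (V : Set (PtD m)) := hV
  have hW' : CombIso (stdCubeVerts n : Set (PtD n)) (W : Set (PtD n)) := hW
  refine ⟨(V ×ˢ W).image (appL m n), (prodTri (toLex : (Fin m → ℝ) → Lex (Fin m → ℝ))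
    (toLex : (Fin n → ℝ) → Lex (Fin n → ℝ)) T U).image (Finset.image (appL m n)), ?_, ?_, ?_⟩
  · have := (hV'.prod hW' (stdCube_convPos m) (stdCube_convPos n)).map (appL m n) (appL m n)
    rw [stdCube_append, ← Finset.coe_product, ← Finset.coe_image] at this
    exact this
  · apply of_tri
    convert ((tri_of hT).prod toLex.injective toLex.injective (tri_of hU)).map (appL m n)
  · rw [Finset.card_image_of_injective _ (Finset.image_injective (appL m n).injective)]
    exact prodTri_card _ _ (tri_of hT) (tri_of hU)

/-- if `f d` is the maximal number of simplices in a triangulation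
of a combinatorial `d`-cube (over all coordinatizations), and
`f d₁ ≥ c₁^{d₁}·d₁!` and `f d₂ ≥ c₂^{d₂}·d₂!`, then
`f (d₁ + d₂) ≥ c₁^{d₁}·c₂^{d₂}·(d₁+d₂)!`. -/
theorem haiman_product_bound (f : ℕ → ℕ)
    (hf : ∀ d, IsGreatest
      {k : ℕ | ∃ V T, IsCombCube d V ∧ IsTriangulationD d V T ∧ T.card = k} (f d))
    (d₁ d₂ : ℕ) (c₁ c₂ : ℝ) (hc₁ : 0 ≤ c₁) (hc₂ : 0 ≤ c₂)
    (h₁ : c₁ ^ d₁ * (d₁.factorial : ℝ) ≤ (f d₁ : ℝ))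
    (h₂ : c₂ ^ d₂ * (d₂.factorial : ℝ) ≤ (f d₂ : ℝ)) :
    c₁ ^ d₁ * c₂ ^ d₂ * ((d₁ + d₂).factorial : ℝ) ≤ (f (d₁ + d₂) : ℝ) := by
  obtain ⟨V, T, hV, hT, hTc⟩ := (hf d₁).1
  obtain ⟨W, U, hW, hU, hUc⟩ := (hf d₂).1
  obtain ⟨X, Y, hX, hY, hc⟩ := prod_bound hV hT hW hU
  have hle : Y.card ≤ f (d₁ + d₂) := (hf (d₁ + d₂)).2 ⟨X, Y, hX, hY, rfl⟩
  rw [hTc, hUc] at hc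
  have h3 : (f d₁ : ℝ) * f d₂ * ((d₁ + d₂).choose d₁ : ℝ) ≤ f (d₁ + d₂) := by
    exact_mod_cast hc.trans hle
  refine le_trans ?_ h3
  have h4 : ((d₁ + d₂).factorial : ℝ) =
      ((d₁ + d₂).choose d₁ : ℝ) * d₁.factorial * d₂.factorial := by
    have := Nat.add_choose_mul_factorial_mul_factorial d₁ d₂
    rw [← Nat.choose_symm_add] at this
    exact_mod_cast this.symm
  rw [h4]
  calc c₁ ^ d₁ * c₂ ^ d₂ * (((d₁ + d₂).choose d₁ : ℝ) * d₁.factorial * d₂.factorial)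
      = (c₁ ^ d₁ * d₁.factorial) * (c₂ ^ d₂ * d₂.factorial) * ((d₁ + d₂).choose d₁ : ℝ) := by ring
    _ ≤ (f d₁ : ℝ) * f d₂ * ((d₁ + d₂).choose d₁ : ℝ) := by gcongr
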